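/- Let n ≥ 3 and let x be an integer with 1 < x < n. If n ≡ 0 (mod 3), x ≡ 0 (mod 3), and 3x > 2n, then the 5-regular circulant graph C_{2n}(x,1,n) is word-representable. -/

import Mathlib

/-- Two letters `x` and `y` alternate in the word `w` if, after deleting all letters
other than `x` and `y`, no two consecutive letters of the resulting word are equal. -/
def Alternate {V : Type*} [DecidableEq V] (w : List V) (x y : V) : Prop :=
  (w.filter (fun z => decide (z = x ∨ z = y))).Chain' (· ≠ ·)

/-- A word `w` represents the graph `G` if it contains every vertex at least once and
two distinct vertices are adjacent in `G` iff they alternate in `w`. -/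
def Represents {V : Type*} [DecidableEq V] (G : SimpleGraph V) (w : List V) : Prop :=
  (∀ v : V, v ∈ w) ∧ ∀ x y : V, x ≠ y → (G.Adj x y ↔ Alternate w x y)

/-- A graph is word-representable if some word represents it. -/
def WordRepresentable {V : Type*} [DecidableEq V] (G : SimpleGraph V) : Prop :=
  ∃ w : List V, Represents G w

/-- A word is `k`-uniform if every letter of the alphabet occurs in it exactly `k` times. -/
def IsKUniform {V : Type*} [DecidableEq V] (w : List V) (k : ℕ) : Prop :=
  ∀ v : V, w.count v = k

/-- A list, in some order and without repetition, of the vertices satisfying `q`. -/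
noncomputable def listOf {V : Type*} [Fintype V] (q : V → Prop) : List V :=
  letI := Classical.decPred q
  (Finset.univ.filter q).toList

section ListOf

variable {V : Type*} [Fintype V] {q : V → Prop} {u w : V}

lemma mem_listOf : u ∈ listOf q ↔ q u := by
  simp [listOf]

lemma nodup_listOf (q : V → Prop) : (listOf q).Nodup :=
  Finset.nodup_toList _

variable [DecidableEq V]

lemma filter_listOf_left (hu : q u) (hw : ¬ q w) :
    (listOf q).filter (fun z => decide (z = u ∨ z = w)) = [u] := by
  rw [← List.perm_singleton, List.perm_ext_iff_of_nodup ((nodup_listOf q).filter _) (by simp)]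
  intro a
  simp only [List.mem_filter, mem_listOf, decide_eq_true_eq, List.mem_singleton]
  grind

lemma filter_listOf_right (hu : ¬ q u) (hw : q w) :
    (listOf q).filter (fun z => decide (z = u ∨ z = w)) = [w] := by
  simpa only [or_comm] using filter_listOf_left hw hu

lemma filter_listOf_neither (hu : ¬ q u) (hw : ¬ q w) :
    (listOf q).filter (fun z => decide (z = u ∨ z = w)) = [] := by
  rw [List.filter_eq_nil_iff]
  intro a ha
  rw [mem_listOf] at ha
  grind

open Classical in
lemma filter_listOf (h : ¬ (q u ∧ q w)) :
    (listOf q).filter (fun z => decide (z = u ∨ z = w)) =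
      if q u then [u] else if q w then [w] else [] := by
  by_cases hu : q u
  · rw [filter_listOf_left hu (fun hw => h ⟨hu, hw⟩), if_pos hu]
  · by_cases hw : q w
    · rw [filter_listOf_right hu hw, if_neg hu, if_pos hw]
    · rw [filter_listOf_neither hu hw, if_neg hu, if_neg hw]

end ListOf

lemma isChain_flatMap_pair {α : Type*} {u w : α} (h : u ≠ w) (l : List α) :
    (l.flatMap (fun _ => [u, w, u, w] ++ [u, w, u, w, u, w, u, w])).IsChain (· ≠ ·) := by
  induction l with
  | nil => simp
  | cons a l ih => cases l <;> simp_all [h.symm]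

section Alternate

variable {V : Type*} [DecidableEq V] {l : List V} {u w : V}

lemma alternate_iff_isChain : Alternate l u w ↔
    (l.filter (fun z => decide (z = u ∨ z = w))).IsChain (· ≠ ·) :=
  Iff.rfl

lemma alternate_comm : Alternate l u w ↔ Alternate l w u := by
  simp only [Alternate, or_comm]

end Alternate

section Blocks

variable {V : Type*} [Fintype V]

/-- Two rounds through the colour classes in which `v` comes first, respectively last, in its
class; no vertex of the class of `v` alternates with `v` here. -/
noncomputable def sameClassBlock (c : V → Fin 3) (v : V) : List V :=
  listOf (fun z => c z = 0 ∧ z = v) ++ (listOf (fun z => c z = 0 ∧ z ≠ v) ++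
  (listOf (fun z => c z = 1 ∧ z = v) ++ (listOf (fun z => c z = 1 ∧ z ≠ v) ++
  (listOf (fun z => c z = 2 ∧ z = v) ++ (listOf (fun z => c z = 2 ∧ z ≠ v) ++
  (listOf (fun z => c z = 0 ∧ z ≠ v) ++ (listOf (fun z => c z = 0 ∧ z = v) ++
  (listOf (fun z => c z = 1 ∧ z ≠ v) ++ (listOf (fun z => c z = 1 ∧ z = v) ++
  (listOf (fun z => c z = 2 ∧ z ≠ v) ++ listOf (fun z => c z = 2 ∧ z = v)))))))))))

/-- Rounds through the colour classes in which `v` is moved across its non-neighbours in the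
preceding class (first two rounds) or, for `v` of colour `2`, in the class `0` of the
following round (last two rounds). -/
noncomputable def crossClassBlock (G : SimpleGraph V) (c : V → Fin 3) (v : V) : List V :=
  listOf (fun z => c z = 0 ∧ G.Adj v z) ++ (listOf (fun z => c z = 1 ∧ z = v) ++
  (listOf (fun z => c z = 0 ∧ ¬ G.Adj v z) ++ (listOf (fun z => c z = 1 ∧ z ≠ v) ++
  (listOf (fun z => c z = 2) ++
  (listOf (fun z => c z = 0) ++
  (listOf (fun z => c z = 1 ∧ G.Adj v z) ++ (listOf (fun z => c z = 2 ∧ z = v) ++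
  (listOf (fun z => c z = 1 ∧ ¬ G.Adj v z) ++ (listOf (fun z => c z = 2 ∧ z ≠ v) ++
  (listOf (fun z => c z = 0) ++ (listOf (fun z => c z = 1) ++
  (listOf (fun z => c z = 2 ∧ z ≠ v) ++ (listOf (fun z => c z = 0 ∧ ¬ G.Adj v z) ++
  (listOf (fun z => c z = 2 ∧ z = v) ++ (listOf (fun z => c z = 0 ∧ G.Adj v z) ++
  (listOf (fun z => c z = 1) ++ listOf (fun z => c z = 2)))))))))))))))))

/-- The concatenation of the blocks of all vertices. -/
noncomputable def coloringWord (G : SimpleGraph V) (c : V → Fin 3) : List V :=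
  (Finset.univ : Finset V).toList.flatMap
    (fun v => sameClassBlock c v ++ crossClassBlock G c v)

lemma mem_coloringWord (G : SimpleGraph V) (c : V → Fin 3) (v : V) : v ∈ coloringWord G c := by
  simp only [coloringWord, List.mem_flatMap, Finset.mem_toList, Finset.mem_univ, true_and]
  refine ⟨v, List.mem_append_left _ ?_⟩
  simp only [sameClassBlock, List.mem_append, mem_listOf]
  generalize c v = i
  fin_cases i <;> simp

variable [DecidableEq V]

lemma filter_sameClassBlock_of_lt {c : V → Fin 3} {u w : V} (h : c u < c w) (v : V) :
    (sameClassBlock c v).filter (fun z => decide (z = u ∨ z = w)) = [u, w, u, w] := by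
  have hne : u ≠ w := by rintro rfl; exact lt_irrefl _ h
  simp only [sameClassBlock, List.filter_append]
  repeat rw [filter_listOf (by grind)]
  generalize hcu : c u = i at *
  generalize hcw : c w = j at *
  by_cases h1 : u = v <;> by_cases h2 : w = v <;> fin_cases i <;> fin_cases j <;> simp_all

lemma filter_crossClassBlock_of_adj {G : SimpleGraph V} {c : V → Fin 3} {u w : V}
    (h : c u < c w) (hadj : G.Adj u w) (v : V) :
    (crossClassBlock G c v).filter (fun z => decide (z = u ∨ z = w)) =
      [u, w, u, w, u, w, u, w] := by
  have hne : u ≠ w := hadj.ne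
  have hadj' := hadj.symm
  simp only [crossClassBlock, List.filter_append]
  repeat rw [filter_listOf (by grind)]
  generalize hcu : c u = i at *
  generalize hcw : c w = j at *
  by_cases h1 : u = v <;> by_cases h2 : w = v <;> by_cases h3 : G.Adj v u <;>
    by_cases h4 : G.Adj v w <;> fin_cases i <;> fin_cases j <;> simp_all

lemma alternate_coloringWord_of_adj {G : SimpleGraph V} {c : V → Fin 3} {u w : V}
    (h : c u < c w) (hadj : G.Adj u w) : Alternate (coloringWord G c) u w := by
  simp only [alternate_iff_isChain, coloringWord, List.filter_flatMap, List.filter_append,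
    filter_sameClassBlock_of_lt h, filter_crossClassBlock_of_adj h hadj]
  exact isChain_flatMap_pair hadj.ne _

lemma Alternate.of_coloringWord {G : SimpleGraph V} {c : V → Fin 3} {u w : V}
    (h : Alternate (coloringWord G c) u w) (v : V) :
    Alternate (sameClassBlock c v) u w ∧ Alternate (crossClassBlock G c v) u w := by
  obtain ⟨s, t, hst⟩ := List.append_of_mem (Finset.mem_toList.2 (Finset.mem_univ v))
  simp only [alternate_iff_isChain, coloringWord, hst, List.flatMap_append, List.flatMap_cons,
    List.filter_append] at h
  have h' := h.right_of_append.left_of_append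
  exact ⟨h'.left_of_append, h'.right_of_append⟩

lemma not_alternate_sameClassBlock {c : V → Fin 3} {u v : V} (hne : u ≠ v) (h : c u = c v) :
    ¬ Alternate (sameClassBlock c v) u v := by
  simp only [alternate_iff_isChain, sameClassBlock, List.filter_append]
  repeat rw [filter_listOf (by grind)]
  generalize hcv : c v = j at *
  fin_cases j <;> simp_all

lemma not_alternate_crossClassBlock {G : SimpleGraph V} {c : V → Fin 3} {u v : V}
    (h : c u < c v) (hadj : ¬ G.Adj u v) : ¬ Alternate (crossClassBlock G c v) u v := by
  have hne : u ≠ v := by rintro rfl; exact lt_irrefl _ h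
  have hadj' : ¬ G.Adj v u := fun h => hadj h.symm
  simp only [alternate_iff_isChain, crossClassBlock, List.filter_append]
  repeat rw [filter_listOf (by grind)]
  generalize hcu : c u = i at *
  generalize hcv : c v = j at *
  fin_cases i <;> fin_cases j <;> simp_all

lemma adj_iff_alternate_coloringWord {G : SimpleGraph V} {c : V → Fin 3} {u v : V}
    (h : c u < c v) : G.Adj u v ↔ Alternate (coloringWord G c) u v :=
  ⟨alternate_coloringWord_of_adj h, fun ha => by
    by_contra hadj
    exact not_alternate_crossClassBlock h hadj (ha.of_coloringWord v).2⟩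

/-- Every finite 3-colourable graph is word-representable. -/
theorem WordRepresentable.of_colorable_three {G : SimpleGraph V} (hG : G.Colorable 3) :
    WordRepresentable G := by
  obtain ⟨c⟩ := hG
  refine ⟨coloringWord G c, mem_coloringWord G c, fun u v hne => ?_⟩
  rcases lt_trichotomy (c u) (c v) with h | h | h
  · exact adj_iff_alternate_coloringWord h
  · refine ⟨fun hadj => (c.valid hadj h).elim, fun ha => ?_⟩
    exact (not_alternate_sameClassBlock hne h (ha.of_coloringWord v).1).elim
  · rw [G.adj_comm, alternate_comm]
    exact adj_iff_alternate_coloringWord h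

end Blocks

/-- The residue of `i` modulo `3`, shifted by one more at each of `x` and `2 * x`. -/
def shiftedColor (x i : ℕ) : ℕ :=
  (i + (if i < x then 0 else if i < 2 * x then 1 else 2)) % 3

lemma shiftedColor_ne {n x a b d : ℕ} (hx1 : 1 < x) (hxn : x < n)
    (h0 : n % 3 = 0) (h1 : x % 3 = 0) (h2 : 2 * n < 3 * x) (ha : a < 2 * n) (hb : b < 2 * n)
    (hd : d = 1 ∨ d = x ∨ d = n) (hab : a = b + d ∨ a + 2 * n = b + d) :
    shiftedColor x a ≠ shiftedColor x b := by
  unfold shiftedColor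
  rcases hd with rfl | rfl | rfl <;> rcases hab with hab | hab <;> split_ifs <;> omega

lemma ZMod.val_eq_add_of_sub_eq {m : ℕ} [NeZero m] {u v : ZMod m} {d : ℕ} (hd : d < m)
    (h : u - v = (d : ZMod m)) : u.val = v.val + d ∨ u.val + m = v.val + d := by
  have huv : u = v + (d : ZMod m) := by rw [← h]; ring
  have hval := congrArg ZMod.val huv
  rw [ZMod.val_add, ZMod.val_natCast_of_lt hd] at hval
  have hv := v.val_lt
  rcases lt_or_ge (v.val + d) m with hlt | hge
  · rw [Nat.mod_eq_of_lt hlt] at hval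
    exact Or.inl hval
  · rw [Nat.mod_eq_sub_mod hge, Nat.mod_eq_of_lt (by omega)] at hval
    omega

theorem stmt6 (n x : ℕ) (hn : 3 ≤ n) (hx1 : 1 < x) (hxn : x < n)
    (h0 : n % 3 = 0) (h1 : x % 3 = 0) (h2 : 2*n < 3*x) :
    WordRepresentable (SimpleGraph.circulantGraph {((1 : ℕ) : ZMod (2*n)), ((x : ℕ) : ZMod (2*n)), ((n : ℕ) : ZMod (2*n))}) := by
  have : NeZero (2 * n) := ⟨by omega⟩
  have key : ∀ u v : ZMod (2 * n), u - v ∈ ({((1 : ℕ) : ZMod (2*n)), ((x : ℕ) : ZMod (2*n)),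
      ((n : ℕ) : ZMod (2*n))} : Set (ZMod (2 * n))) →
      shiftedColor x u.val ≠ shiftedColor x v.val := by
    intro u v h
    obtain ⟨d, hd, hdlt, huv⟩ : ∃ d : ℕ, (d = 1 ∨ d = x ∨ d = n) ∧ d < 2 * n ∧
        u - v = (d : ZMod (2 * n)) := by
      rcases h with h | h | h
      · exact ⟨1, by simp, by omega, h⟩
      · exact ⟨x, by simp, by omega, h⟩
      · exact ⟨n, by simp, by omega, h⟩
    exact shiftedColor_ne hx1 hxn h0 h1 h2 u.val_lt v.val_lt hd
      (ZMod.val_eq_add_of_sub_eq hdlt huv)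
  refine WordRepresentable.of_colorable_three ⟨SimpleGraph.Coloring.mk
    (fun u => (⟨shiftedColor x u.val, Nat.mod_lt _ (by norm_num)⟩ : Fin 3)) ?_⟩
  intro u v hadj heq
  have hval := congrArg Fin.val heq
  rw [SimpleGraph.circulantGraph, SimpleGraph.fromRel_adj] at hadj
  rcases hadj.2 with h | h
  · exact key u v h hval
  · exact key v u h hval.symm
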